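/- Fix z = E + iη ∈ ℂ⁺ and N ∈ ℕ with N ≥ 1, and real sequences α₁,…,α_N ≥ 1 and β₁,…,β_N ≥ 1. Then there exists a pair (u, v) ∈ ℂ⁺ × ℂ⁺ satisfying u = -(1/N) Σ_{k=1}^N α_k / (z + α_k u + β_k v) and v = -(1/N) Σ_{k=1}^N β_k / (z + α_k u + β_k v). -/

import Mathlib

open Complex

namespace Aux

/-- One component of the map. -/
noncomputable def G {N : ℕ} (z : ℂ) (α β w : Fin N → ℝ) (p : ℂ × ℂ) : ℂ :=
  -(1 / N) * ∑ k, (w k : ℂ) / (z + α k * p.1 + β k * p.2)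

lemma im_term (w : ℝ) (D : ℂ) : (-((w : ℂ) / D)).im = w * (D.im / ‖D‖ ^ 2) := by
  rw [← Complex.normSq_eq_norm_sq]
  simp [Complex.div_im]
  ring

lemma G_im {N : ℕ} (z : ℂ) (α β w : Fin N → ℝ) (p : ℂ × ℂ) :
    (G z α β w p).im = (1 / N : ℝ) * ∑ k, w k *
      ((z + α k * p.1 + β k * p.2).im / ‖z + α k * p.1 + β k * p.2‖ ^ 2) := by
  have : G z α β w p = ((1 / N : ℝ) : ℂ) * ∑ k, -((w k : ℂ) / (z + α k * p.1 + β k * p.2)) := by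
    unfold G
    rw [Finset.sum_neg_distrib]
    push_cast
    ring
  rw [this, Complex.im_ofReal_mul, Complex.im_sum]
  simp only [im_term]

lemma D_im (z u v : ℂ) (a b : ℝ) : (z + a * u + b * v).im = z.im + a * u.im + b * v.im := by
  simp

lemma cs2 (a b c d : ℝ) (ha : 0 ≤ a) (hb : 0 ≤ b) (hc : 0 ≤ c) (hd : 0 ≤ d) :
    √a * √b + √c * √d ≤ √(a + c) * √(b + d) := by
  rw [← Real.sqrt_mul (show 0 ≤ a + c by positivity)]
  apply Real.le_sqrt_of_sq_le
  have h1 := Real.sq_sqrt ha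
  have h2 := Real.sq_sqrt hb
  have h3 := Real.sq_sqrt hc
  have h4 := Real.sq_sqrt hd
  have : (a + c) * (b + d) = (√a ^ 2 + √c ^ 2) * (√b ^ 2 + √d ^ 2) := by rw [h1, h2, h3, h4]
  rw [this]
  nlinarith [sq_nonneg (√a * √d - √c * √b)]

lemma D_diff (z u v u' v' : ℂ) (a b δ : ℝ) (hz : 0 < z.im) (ha : 0 < a) (hb : 0 < b)
    (hδ : 0 < δ)
    (hu : 0 < u.im) (hv : 0 < v.im) (hu' : 0 < u'.im) (hv' : 0 < v'.im)
    (h1 : ‖u - u'‖ ≤ δ * (√u.im * √u'.im)) (h2 : ‖v - v'‖ ≤ δ * (√v.im * √v'.im)) :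
    ‖(z + a * u + b * v) - (z + a * u' + b * v')‖ <
      δ * (√(z + a * u + b * v).im * √(z + a * u' + b * v').im) := by
  have e : (z + a * u + b * v) - (z + a * u' + b * v') = a * (u - u') + b * (v - v') := by ring
  rw [e]
  have n1 : ‖(a : ℂ) * (u - u') + b * (v - v')‖ ≤ a * ‖u - u'‖ + b * ‖v - v'‖ := by
    refine (norm_add_le _ _).trans ?_
    simp [abs_of_pos ha, abs_of_pos hb]
  have n2 := cs2 (a * u.im) (a * u'.im) (b * v.im) (b * v'.im) (by positivity) (by positivity)
    (by positivity) (by positivity)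
  have e1 : √(a * u.im) * √(a * u'.im) = a * (√u.im * √u'.im) := by
    rw [Real.sqrt_mul ha.le, Real.sqrt_mul ha.le]
    rw [mul_mul_mul_comm, Real.mul_self_sqrt ha.le]
  have e2 : √(b * v.im) * √(b * v'.im) = b * (√v.im * √v'.im) := by
    rw [Real.sqrt_mul hb.le, Real.sqrt_mul hb.le]
    rw [mul_mul_mul_comm, Real.mul_self_sqrt hb.le]
  rw [e1, e2] at n2
  have n3 : √(a * u.im + b * v.im) * √(a * u'.im + b * v'.im) <
      √(z + a * u + b * v).im * √(z + a * u' + b * v').im := by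
    rw [D_im, D_im]
    have p1 : 0 < a * u.im + b * v.im := by positivity
    have p2 : 0 < a * u'.im + b * v'.im := by positivity
    apply mul_lt_mul'' _ _ (by positivity) (by positivity)
    · exact Real.sqrt_lt_sqrt p1.le (by linarith)
    · exact Real.sqrt_lt_sqrt p2.le (by linarith)
  calc _ ≤ _ := n1
    _ ≤ a * (δ * (√u.im * √u'.im)) + b * (δ * (√v.im * √v'.im)) := by gcongr
    _ = δ * (a * (√u.im * √u'.im) + b * (√v.im * √v'.im)) := by ring
    _ < _ := by
      apply mul_lt_mul_of_pos_left _ hδ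
      exact n2.trans_lt n3

lemma contr {N : ℕ} (hN : 1 ≤ N) (z : ℂ) (hz : 0 < z.im) (α β w : Fin N → ℝ)
    (hα : ∀ k, 1 ≤ α k) (hβ : ∀ k, 1 ≤ β k) (hw : ∀ k, 1 ≤ w k) (p p' : ℂ × ℂ) (δ : ℝ)
    (hδ : 0 < δ)
    (hu : 0 < p.1.im) (hv : 0 < p.2.im) (hu' : 0 < p'.1.im) (hv' : 0 < p'.2.im)
    (h1 : ‖p.1 - p'.1‖ ≤ δ * (√p.1.im * √p'.1.im))
    (h2 : ‖p.2 - p'.2‖ ≤ δ * (√p.2.im * √p'.2.im)) :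
    ‖G z α β w p - G z α β w p'‖ < δ * (√(G z α β w p).im * √(G z α β w p').im) := by
  have hNpos : (0 : ℝ) < N := by exact_mod_cast hN
  rw [G_im, G_im]
  set D : Fin N → ℂ := fun k => z + α k * p.1 + β k * p.2 with hD
  set D' : Fin N → ℂ := fun k => z + α k * p'.1 + β k * p'.2 with hD'
  have hα0 : ∀ k, 0 < α k := fun k => by linarith [hα k]
  have hβ0 : ∀ k, 0 < β k := fun k => by linarith [hβ k]
  have hw0 : ∀ k, 0 < w k := fun k => by linarith [hw k]
  have hDi : ∀ k, 0 < (D k).im := fun k => by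
    have := hα0 k; have := hβ0 k
    simp only [hD, D_im]; positivity
  have hDi' : ∀ k, 0 < (D' k).im := fun k => by
    have := hα0 k; have := hβ0 k
    simp only [hD', D_im]; positivity
  have hD0 : ∀ k, D k ≠ 0 := fun k h => by have := hDi k; simp [h] at this
  have hD0' : ∀ k, D' k ≠ 0 := fun k h => by have := hDi' k; simp [h] at this
  have hdiff : ∀ k, ‖D k - D' k‖ < δ * (√(D k).im * √(D' k).im) := fun k =>
    D_diff z _ _ _ _ _ _ δ hz (hα0 k) (hβ0 k) hδ hu hv hu' hv' h1 h2
  have eG : G z α β w p - G z α β w p' =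
      ((1 / N : ℝ) : ℂ) * ∑ k, (w k : ℂ) * ((D k - D' k) / (D k * D' k)) := by
    unfold G
    rw [← mul_sub, ← Finset.sum_sub_distrib]
    push_cast
    rw [neg_mul, ← mul_neg, ← Finset.sum_neg_distrib]
    congr 1
    apply Finset.sum_congr rfl
    intro k _
    change -((w k : ℂ) / D k - (w k : ℂ) / D' k) = _
    have := hD0 k; have := hD0' k
    field_simp
    ring
  change _ < δ * (√((1 / N : ℝ) * ∑ k, w k * ((D k).im / ‖D k‖ ^ 2)) *
    √((1 / N : ℝ) * ∑ k, w k * ((D' k).im / ‖D' k‖ ^ 2)))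
  have hne : (Finset.univ : Finset (Fin N)).Nonempty := ⟨⟨0, hN⟩, Finset.mem_univ _⟩
  have s1 : ‖G z α β w p - G z α β w p'‖ <
      (1 / N : ℝ) * ∑ k, δ * (√(w k * ((D k).im / ‖D k‖ ^ 2)) *
        √(w k * ((D' k).im / ‖D' k‖ ^ 2))) := by
    rw [eG, norm_mul, Complex.norm_real, Real.norm_of_nonneg (by positivity)]
    apply mul_lt_mul_of_pos_left _ (by positivity)
    refine (norm_sum_le _ _).trans_lt ?_
    apply Finset.sum_lt_sum_of_nonempty hne
    intro k _
    have a1 := norm_pos_iff.2 (hD0 k)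
    have a2 := norm_pos_iff.2 (hD0' k)
    have a3 := hw0 k
    rw [norm_mul, norm_div, norm_mul, Complex.norm_real, Real.norm_of_nonneg a3.le,
      Real.sqrt_mul a3.le, Real.sqrt_mul a3.le, Real.sqrt_div (hDi k).le,
      Real.sqrt_div (hDi' k).le, Real.sqrt_sq a1.le, Real.sqrt_sq a2.le]
    calc _ < w k * (δ * (√(D k).im * √(D' k).im) / (‖D k‖ * ‖D' k‖)) := by
          apply mul_lt_mul_of_pos_left _ a3
          exact div_lt_div_of_pos_right (hdiff k) (by positivity)
      _ = (√(w k) * √(w k)) * (δ * (√(D k).im * √(D' k).im) / (‖D k‖ * ‖D' k‖)) := by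
          rw [Real.mul_self_sqrt a3.le]
      _ = _ := by field_simp
  refine s1.trans_le ?_
  rw [← Finset.mul_sum]
  have cs := Real.sum_sqrt_mul_sqrt_le (Finset.univ : Finset (Fin N))
    (f := fun k => w k * ((D k).im / ‖D k‖ ^ 2)) (g := fun k => w k * ((D' k).im / ‖D' k‖ ^ 2))
    (fun k => by have := hw0 k; have := hDi k; positivity)
    (fun k => by have := hw0 k; have := hDi' k; positivity)
  have i0 : (0 : ℝ) ≤ 1 / N := by positivity
  rw [Real.sqrt_mul i0, Real.sqrt_mul i0]
  calc _ = (1 / N : ℝ) * δ * _ := by rw [mul_assoc]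
    _ ≤ (1 / N : ℝ) * δ * _ := mul_le_mul_of_nonneg_left cs (by positivity)
    _ = (√(1 / N : ℝ) * √(1 / N : ℝ)) * δ * _ := by rw [Real.mul_self_sqrt i0]
    _ = _ := by ring

lemma bounds {N : ℕ} (hN : 1 ≤ N) (z : ℂ) (hz : 0 < z.im) (α β w : Fin N → ℝ) (A R : ℝ)
    (hα : ∀ k, 1 ≤ α k) (hβ : ∀ k, 1 ≤ β k) (hw : ∀ k, 1 ≤ w k)
    (hαA : ∀ k, α k ≤ A) (hβA : ∀ k, β k ≤ A) (hwA : ∀ k, w k ≤ A) (hR : R = A / z.im)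
    (p : ℂ × ℂ) (hu : 0 < p.1.im) (hv : 0 < p.2.im) (hu' : ‖p.1‖ ≤ R) (hv' : ‖p.2‖ ≤ R) :
    ‖G z α β w p‖ ≤ R ∧ z.im / (‖z‖ + A * R + A * R) ^ 2 ≤ (G z α β w p).im := by
  have hNpos : (0 : ℝ) < N := by exact_mod_cast hN
  have hα0 : ∀ k, 0 < α k := fun k => by linarith [hα k]
  have hβ0 : ∀ k, 0 < β k := fun k => by linarith [hβ k]
  have hw0 : ∀ k, 0 < w k := fun k => by linarith [hw k]
  have hDi : ∀ k, z.im ≤ (z + α k * p.1 + β k * p.2).im := fun k => by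
    have := mul_pos (hα0 k) hu; have := mul_pos (hβ0 k) hv
    rw [D_im]; linarith
  have hDn : ∀ k, z.im ≤ ‖z + α k * p.1 + β k * p.2‖ := fun k =>
    (hDi k).trans (Complex.im_le_norm _)
  have hA : 0 < A := (hα0 ⟨0, hN⟩).trans_le (hαA _)
  have hDM : ∀ k, ‖z + α k * p.1 + β k * p.2‖ ≤ ‖z‖ + A * R + A * R := fun k => by
    refine (norm_add₃_le).trans ?_
    rw [norm_mul, norm_mul, Complex.norm_real, Complex.norm_real,
      Real.norm_of_nonneg (hα0 k).le, Real.norm_of_nonneg (hβ0 k).le]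
    have := hαA k; have := hβA k
    gcongr
  constructor
  · unfold G
    have : ‖∑ k, (w k : ℂ) / (z + α k * p.1 + β k * p.2)‖ ≤ ∑ k : Fin N, R := by
      refine norm_sum_le_of_le _ fun k _ => ?_
      rw [norm_div, Complex.norm_real, Real.norm_of_nonneg (hw0 k).le, hR]
      have := hDn k; have := hwA k
      gcongr
    rw [norm_mul, norm_neg, norm_div, norm_one, Complex.norm_natCast]
    simp only [Finset.sum_const, Finset.card_univ, Fintype.card_fin, nsmul_eq_mul] at this
    calc _ ≤ (1 / N : ℝ) * (N * R) := by gcongr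
      _ = R := by field_simp
  · rw [G_im]
    have : ∑ k : Fin N, z.im / (‖z‖ + A * R + A * R) ^ 2 ≤ ∑ k, w k *
      ((z + α k * p.1 + β k * p.2).im / ‖z + α k * p.1 + β k * p.2‖ ^ 2) := by
      refine Finset.sum_le_sum fun k _ => ?_
      have h1 := hDn k; have h2 := hDi k; have h3 := hDM k
      have h4 : 0 < ‖z + α k * p.1 + β k * p.2‖ := by linarith
      have h5 : 0 < (z + α k * p.1 + β k * p.2).im := by linarith
      calc _ ≤ (z + α k * p.1 + β k * p.2).im / ‖z + α k * p.1 + β k * p.2‖ ^ 2 := by gcongr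
        _ ≤ _ := le_mul_of_one_le_left (by positivity) (hw k)
    simp only [Finset.sum_const, Finset.card_univ, Fintype.card_fin, nsmul_eq_mul] at this
    calc z.im / (‖z‖ + A * R + A * R) ^ 2
        = (1 / N : ℝ) * (N * (z.im / (‖z‖ + A * R + A * R) ^ 2)) := by field_simp
      _ ≤ _ := by gcongr

end Aux

open Aux in
/-- existence of a solution `(u, v) ∈ ℂ⁺ × ℂ⁺` to the self-consistent system. -/
theorem stmt_2 (z : ℂ) (hz : 0 < z.im) (N : ℕ) (hN : 1 ≤ N)
    (α β : Fin N → ℝ) (hα : ∀ k, 1 ≤ α k) (hβ : ∀ k, 1 ≤ β k) :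
    ∃ u v : ℂ, 0 < u.im ∧ 0 < v.im ∧
      u = -(1 / N) * ∑ k, (α k : ℂ) / (z + α k * u + β k * v) ∧
      v = -(1 / N) * ∑ k, (β k : ℂ) / (z + α k * u + β k * v) := by
  have hα0 : ∀ k, 0 < α k := fun k => by linarith [hα k]
  have hβ0 : ∀ k, 0 < β k := fun k => by linarith [hβ k]
  obtain ⟨A, hA1, hαA, hβA⟩ : ∃ A : ℝ, 1 ≤ A ∧ (∀ k, α k ≤ A) ∧ (∀ k, β k ≤ A) := by
    have sa : 0 ≤ ∑ k, α k := Finset.sum_nonneg fun k _ => (hα0 k).le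
    have sb : 0 ≤ ∑ k, β k := Finset.sum_nonneg fun k _ => (hβ0 k).le
    refine ⟨1 + ∑ k, α k + ∑ k, β k, by linarith, fun k => ?_, fun k => ?_⟩
    · have := Finset.single_le_sum (f := α) (fun k _ => (hα0 k).le) (Finset.mem_univ k)
      linarith
    · have := Finset.single_le_sum (f := β) (fun k _ => (hβ0 k).le) (Finset.mem_univ k)
      linarith
  obtain ⟨R, hR⟩ : ∃ R, R = A / z.im := ⟨_, rfl⟩
  have hRpos : 0 < R := by rw [hR]; positivity
  obtain ⟨c, hc⟩ : ∃ c, c = z.im / (‖z‖ + A * R + A * R) ^ 2 := ⟨_, rfl⟩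
  have hcpos : 0 < c := by rw [hc]; positivity
  have hcR : c ≤ R := by
    have h1 : z.im ≤ ‖z‖ + A * R + A * R := by
      have := Complex.im_le_norm z
      have : 0 < A * R := by positivity
      linarith
    calc c ≤ z.im / z.im ^ 2 := by rw [hc]; gcongr
      _ = 1 / z.im := by field_simp
      _ ≤ R := by rw [hR]; gcongr
  let S : Set ℂ := Metric.closedBall 0 R ∩ {u | c ≤ u.im}
  have hS : IsCompact S := (isCompact_closedBall 0 R).inter_right
    (isClosed_le continuous_const Complex.continuous_im)
  have hK : IsCompact (S ×ˢ S) := hS.prod hS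
  have hmem : ∀ u, u ∈ S ↔ ‖u‖ ≤ R ∧ c ≤ u.im := fun u => by simp [S]
  have hSne : (S ×ˢ S).Nonempty := by
    have : (R * I : ℂ) ∈ S := by
      rw [hmem]; simp [abs_of_pos hRpos, hcR]
    exact ⟨(R * I, R * I), this, this⟩
  have hmap : ∀ w : Fin N → ℝ, (∀ k, 1 ≤ w k) → (∀ k, w k ≤ A) → ∀ p ∈ S ×ˢ S,
      G z α β w p ∈ S := by
    rintro w hw hwA p ⟨h1, h2⟩
    rw [hmem] at h1 h2 ⊢
    have := bounds hN z hz α β w A R hα hβ hw hαA hβA hwA hR p (by linarith) (by linarith)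
      h1.1 h2.1
    rwa [← hc] at this
  have hcont : ∀ w : Fin N → ℝ, ContinuousOn (G z α β w) (S ×ˢ S) := by
    intro w
    unfold G
    refine continuousOn_const.mul (continuousOn_finsetSum _ fun k _ => ?_)
    refine continuousOn_const.div (by fun_prop) ?_
    rintro p ⟨h1, h2⟩ h0
    rw [hmem] at h1 h2
    have h3 := D_im z p.1 p.2 (α k) (β k)
    rw [h0] at h3
    have := mul_pos (hα0 k) (hcpos.trans_le h1.2)
    have := mul_pos (hβ0 k) (hcpos.trans_le h2.2)
    simp at h3
    linarith
  let φ : ℂ × ℂ → ℝ := fun p => max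
    (‖p.1 - G z α β α p‖ / (√p.1.im * √(G z α β α p).im))
    (‖p.2 - G z α β β p‖ / (√p.2.im * √(G z α β β p).im))
  have hpos : ∀ u ∈ S, 0 < √u.im := fun u hu => Real.sqrt_pos.2 (hcpos.trans_le ((hmem u).1 hu).2)
  have him : ∀ u ∈ S, 0 < u.im := fun u hu => (hcpos.trans_le ((hmem u).1 hu).2)
  have hφ : ContinuousOn φ (S ×ˢ S) := by
    have ca := hcont α
    have cb := hcont β
    have ia := Complex.continuous_im.comp_continuousOn ca
    have ib := Complex.continuous_im.comp_continuousOn cb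
    refine ContinuousOn.sup (ContinuousOn.div ?_ ?_ ?_) (ContinuousOn.div ?_ ?_ ?_)
    · exact (continuousOn_fst.sub ca).norm
    · exact (Complex.continuous_im.comp_continuousOn continuousOn_fst).sqrt.mul ia.sqrt
    · intro p hp
      exact (mul_pos (hpos _ hp.1) (hpos _ (hmap α hα hαA p hp))).ne'
    · exact (continuousOn_snd.sub cb).norm
    · exact (Complex.continuous_im.comp_continuousOn continuousOn_snd).sqrt.mul ib.sqrt
    · intro p hp
      exact (mul_pos (hpos _ hp.2) (hpos _ (hmap β hβ hβA p hp))).ne'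
  obtain ⟨p, hp, hmin⟩ := hK.exists_isMinOn hSne hφ
  have q1 := hmap α hα hαA p hp
  have q2 := hmap β hβ hβA p hp
  set q : ℂ × ℂ := (G z α β α p, G z α β β p) with hq
  have hqK : q ∈ S ×ˢ S := ⟨q1, q2⟩
  have r1 := hmap α hα hαA q hqK
  have r2 := hmap β hβ hβA q hqK
  have d1 : 0 < √p.1.im * √q.1.im := mul_pos (hpos _ hp.1) (hpos _ q1)
  have d2 : 0 < √p.2.im * √q.2.im := mul_pos (hpos _ hp.2) (hpos _ q2)
  have b1 : ‖p.1 - q.1‖ ≤ φ p * (√p.1.im * √q.1.im) := (div_le_iff₀ d1).1 (le_max_left _ _)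
  have b2 : ‖p.2 - q.2‖ ≤ φ p * (√p.2.im * √q.2.im) := (div_le_iff₀ d2).1 (le_max_right _ _)
  have hle : φ p ≤ 0 := by
    by_contra! hlt
    have c1 := contr hN z hz α β α hα hβ hα p q (φ p) hlt (him _ hp.1) (him _ hp.2)
      (him _ q1) (him _ q2) b1 b2
    have c2 := contr hN z hz α β β hα hβ hβ p q (φ p) hlt (him _ hp.1) (him _ hp.2)
      (him _ q1) (him _ q2) b1 b2
    have : φ q < φ p := max_lt
      ((div_lt_iff₀ (mul_pos (hpos _ q1) (hpos _ r1))).2 c1)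
      ((div_lt_iff₀ (mul_pos (hpos _ q2) (hpos _ r2))).2 c2)
    exact absurd (hmin hqK) (not_le.2 this)
  have e1 : p.1 = q.1 := by
    have : ‖p.1 - q.1‖ ≤ 0 := b1.trans (mul_nonpos_of_nonpos_of_nonneg hle d1.le)
    exact sub_eq_zero.1 (norm_le_zero_iff.1 this)
  have e2 : p.2 = q.2 := by
    have : ‖p.2 - q.2‖ ≤ 0 := b2.trans (mul_nonpos_of_nonpos_of_nonneg hle d2.le)
    exact sub_eq_zero.1 (norm_le_zero_iff.1 this)
  exact ⟨p.1, p.2, him _ hp.1, him _ hp.2, e1, e2⟩
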